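/- arXiv:1901.08360 — 8 statements merged into one kernel-verified Lean document; each statement's English description precedes it below -/
import Mathlib

section
/- Let {x_i}_{i∈I} and {y_j}_{j∈J} be finite families of points in ℝ^d that are linearly separable, and suppose there exist a finite orthonormal family of vectors {r_k}_{k∈K} in ℝ^d and scalars {Δ_k}_{k∈K} such that ⟨r_k, x_i⟩ = ⟨r_k, y_j⟩ = Δ_k for all i∈I, j∈J, k∈K. Let (w̄, B) ∈ ℝ^d × ℝ be a minimizer of ‖w‖² + b² over all (w, b) satisfying ⟨w, x_i⟩ + b ≥ 1 for all i∈I and ⟨w, y_j⟩ + b ≤ −1 for all j∈J. Let γ > 0 be the hard margin of the two families. Then ‖w̄‖² ≥ 1/γ² + B² · Σ_{k∈K} Δ_k²; equivalently, the margin 1/‖w̄‖ attained by the decision boundary ⟨w̄, ·⟩ + B = 0 is at most 1/√(1/γ² + B² Σ_{k∈K} Δ_k²). -/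
open scoped RealInnerProductSpace

/-- A quadratic without constant term that is nonnegative everywhere has no linear term. -/
theorem linear_coeff_eq_zero_of_quadratic_nonneg {a c : ℝ}
    (h : ∀ t : ℝ, 0 ≤ t * a + t ^ 2 * c) : a = 0 := by
  have hd := discrim_le_zero (a := c) (b := a) (c := 0) fun t => by linarith [h t]
  have ha : a ^ 2 ≤ 0 := by simpa [discrim] using hd
  exact pow_eq_zero_iff two_ne_zero |>.mp (le_antisymm ha (sq_nonneg a))

section

variable {E : Type*} [NormedAddCommGroup E] [InnerProductSpace ℝ E]

/-- If `(w, b)` minimizes `‖w‖² + b²` along the line through it in direction `(-r, δ)`, then it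
is orthogonal to that direction. -/
theorem inner_eq_mul_of_forall_norm_sq_add_sq_le {w r : E} {b δ : ℝ}
    (h : ∀ t : ℝ, ‖w‖ ^ 2 + b ^ 2 ≤ ‖w - t • r‖ ^ 2 + (b + t * δ) ^ 2) :
    ⟪w, r⟫ = b * δ := by
  have := linear_coeff_eq_zero_of_quadratic_nonneg (a := 2 * (b * δ - ⟪w, r⟫))
    (c := ‖r‖ ^ 2 + δ ^ 2) fun t => by
      have ht := h t
      rw [norm_sub_sq_real, real_inner_smul_right, norm_smul, mul_pow, Real.norm_eq_abs,
        sq_abs] at ht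
      linarith
  linarith

/-- Subtracting the projection onto an orthonormal family decreases the squared norm by the sum
of the squares of the coefficients. -/
theorem Orthonormal.norm_sub_sum_inner_smul_sq {K : Type*} [Fintype K] {r : K → E}
    (hr : Orthonormal ℝ r) (w : E) :
    ‖w - ∑ k, ⟪w, r k⟫ • r k‖ ^ 2 = ‖w‖ ^ 2 - ∑ k, ⟪w, r k⟫ ^ 2 := by
  have hpp : ‖∑ k, ⟪w, r k⟫ • r k‖ ^ 2 = ∑ k, ⟪w, r k⟫ ^ 2 := by
    rw [← real_inner_self_eq_norm_sq, hr.inner_sum]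
    simp [sq]
  have hwp : ⟪w, ∑ k, ⟪w, r k⟫ • r k⟫ = ∑ k, ⟪w, r k⟫ ^ 2 := by
    simp [inner_sum, real_inner_smul_right, sq]
  rw [norm_sub_sq_real, hpp, hwp]
  ring

/-- If `2γ` bounds the separation achieved by unit vectors, then any vector achieving separation
`2` has squared norm at least `1 / γ²`. -/
theorem one_div_sq_le_norm_sq_of_separation {I J : Type*} [Nonempty I] [Nonempty J]
    {x : I → E} {y : J → E} {γ : ℝ} (hγ : 0 < γ)
    (hmargin : 2 * γ ∈ upperBounds {c : ℝ | ∃ u : E, ‖u‖ = 1 ∧ ∀ i j, c ≤ ⟪x i - y j, u⟫})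
    {v : E} (hv : ∀ i j, 2 ≤ ⟪x i - y j, v⟫) : 1 / γ ^ 2 ≤ ‖v‖ ^ 2 := by
  have hv0 : v ≠ 0 := by
    rintro rfl
    have := hv (Classical.arbitrary I) (Classical.arbitrary J)
    norm_num at this
  have hpos : 0 < ‖v‖ := norm_pos_iff.mpr hv0
  have hle : ‖v‖⁻¹ * 2 ≤ 2 * γ := hmargin ⟨‖v‖⁻¹ • v, norm_smul_inv_norm hv0, fun i j => by
    rw [real_inner_smul_right]
    exact mul_le_mul_of_nonneg_left (hv i j) (inv_nonneg.mpr hpos.le)⟩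
  have hinv : γ⁻¹ ≤ ‖v‖ := inv_le_of_inv_le₀ hpos (by linarith)
  rw [one_div, ← inv_pow]
  exact pow_le_pow_left₀ (inv_nonneg.mpr hγ.le) hinv 2

end

/-- **Theorem 1.** If the linearly separable points `x i`, `y j` lie on the affine
subspace `⟪r k, ·⟫ = Δ k` for an orthonormal family `r`, and `(w̄, B)` is the minimizer of
`‖w‖² + b²` subject to `⟪w, x i⟫ + b ≥ 1` and `⟪w, y j⟫ + b ≤ -1` (the limit direction of
cross-entropy minimization), then `‖w̄‖² ≥ 1/γ² + B² ∑ₖ Δₖ²`, where `γ` is the hard margin;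
i.e. the obtained margin `1/‖w̄‖` is at most `1/√(1/γ² + B² ∑ₖ Δₖ²)`. -/
theorem cross_entropy_low_rank_poor_margin
    {d : ℕ} {I J K : Type*} [Fintype I] [Fintype J] [Fintype K]
    [Nonempty I] [Nonempty J] [Nonempty K]
    (x : I → EuclideanSpace ℝ (Fin d)) (y : J → EuclideanSpace ℝ (Fin d))
    (hsep : ∃ (w : EuclideanSpace ℝ (Fin d)) (b : ℝ),
      (∀ i, 0 < ⟪w, x i⟫ + b) ∧ (∀ j, ⟪w, y j⟫ + b < 0))
    (r : K → EuclideanSpace ℝ (Fin d)) (hr : Orthonormal ℝ r)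
    (Δ : K → ℝ)
    (hxr : ∀ k i, ⟪r k, x i⟫ = Δ k)
    (hyr : ∀ k j, ⟪r k, y j⟫ = Δ k)
    (γ : ℝ) (hγ : 0 < γ)
    (hmargin : IsGreatest {c : ℝ | ∃ u : EuclideanSpace ℝ (Fin d), ‖u‖ = 1 ∧
      ∀ i j, c ≤ ⟪x i - y j, u⟫} (2 * γ))
    (wbar : EuclideanSpace ℝ (Fin d)) (B : ℝ)
    (hfeas₁ : ∀ i, 1 ≤ ⟪wbar, x i⟫ + B)
    (hfeas₂ : ∀ j, ⟪wbar, y j⟫ + B ≤ -1)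
    (hmin : ∀ (w : EuclideanSpace ℝ (Fin d)) (b : ℝ),
      (∀ i, 1 ≤ ⟪w, x i⟫ + b) → (∀ j, ⟪w, y j⟫ + b ≤ -1) →
      ‖wbar‖ ^ 2 + B ^ 2 ≤ ‖w‖ ^ 2 + b ^ 2) :
    1 / γ ^ 2 + B ^ 2 * ∑ k, (Δ k) ^ 2 ≤ ‖wbar‖ ^ 2 := by
  have hwr : ∀ k, ⟪wbar, r k⟫ = B * Δ k := fun k =>
    inner_eq_mul_of_forall_norm_sq_add_sq_le fun t => by
      refine hmin _ _ (fun i => ?_) fun j => ?_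
      · rw [inner_sub_left, real_inner_smul_left, hxr]
        linarith [hfeas₁ i]
      · rw [inner_sub_left, real_inner_smul_left, hyr]
        linarith [hfeas₂ j]
  have hsum : ∑ k, ⟪wbar, r k⟫ ^ 2 = B ^ 2 * ∑ k, Δ k ^ 2 := by
    simp only [hwr, mul_pow, Finset.mul_sum]
  have horth : ∀ i j, ⟪x i - y j, ∑ k, ⟪wbar, r k⟫ • r k⟫ = 0 := fun i j => by
    rw [inner_sum]
    refine Finset.sum_eq_zero fun k _ => ?_
    rw [real_inner_smul_right, real_inner_comm (r k) (x i - y j), inner_sub_right, hxr, hyr,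
      sub_self, mul_zero]
  have hv := one_div_sq_le_norm_sq_of_separation hγ hmargin.2
    (v := wbar - ∑ k, ⟪wbar, r k⟫ • r k) fun i j => by
      rw [inner_sub_right, horth, sub_zero, real_inner_comm, inner_sub_right]
      linarith [hfeas₁ i, hfeas₂ j]
  rw [hr.norm_sub_sum_inner_smul_sq, hsum] at hv
  linarith
end

section
/- Let {x_i}_{i∈I} and {y_j}_{j∈J} be finite families of points in ℝ^d that are linearly separable, and suppose there exist a finite orthonormal family {r_k}_{k∈K} in ℝ^d and nonnegative scalars {Δ_k}_{k∈K} such that ⟨r_k, x_i⟩ ≥ Δ_k and ⟨r_k, y_j⟩ ≤ Δ_k for all i∈I, j∈J, k∈K. Let (w̄, B) ∈ ℝ^d × ℝ be a minimizer of ‖w‖² + b² over all (w, b) satisfying ⟨w, x_i⟩ + b ≥ 1 for all i∈I and ⟨w, y_j⟩ + b ≤ −1 for all j∈J, and assume B ≥ 0. Then ‖w̄‖² ≥ B² · Σ_{k∈K} Δ_k²; equivalently, the margin 1/‖w̄‖ of the decision boundary ⟨w̄, ·⟩ + B = 0 is at most 1/√(B² Σ_{k∈K} Δ_k²). -/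
open scoped RealInnerProductSpace

/-- If the squared norm of `(w, b)` does not decrease when moving from `(w, b)` along the ray
with direction `(v, -c)`, then `(w, b)` has nonnegative inner product with `(v, -c)`. -/
theorem mul_le_inner_of_norm_sq_add_sq_le {E : Type*} [NormedAddCommGroup E]
    [InnerProductSpace ℝ E] {w v : E} {b c : ℝ}
    (h : ∀ t : ℝ, 0 ≤ t → ‖w‖ ^ 2 + b ^ 2 ≤ ‖w + t • v‖ ^ 2 + (b - t * c) ^ 2) :
    b * c ≤ ⟪v, w⟫ := by
  by_contra! hlt
  have hv : 0 ≤ ‖v‖ ^ 2 := by positivity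
  have hs : 0 < 1 + ‖v‖ ^ 2 + c ^ 2 := by positivity
  obtain ⟨t, ht, hts⟩ : ∃ t : ℝ, 0 < t ∧ t * (1 + ‖v‖ ^ 2 + c ^ 2) = b * c - ⟪v, w⟫ :=
    ⟨(b * c - ⟪v, w⟫) / (1 + ‖v‖ ^ 2 + c ^ 2), div_pos (by linarith) hs,
      div_mul_cancel₀ _ hs.ne'⟩
  have h1 := h t ht.le
  rw [norm_add_sq_real, inner_smul_right, norm_smul, mul_pow, Real.norm_eq_abs, sq_abs,
    real_inner_comm v w] at h1
  have h2 : t * (b * c - ⟪v, w⟫) = t ^ 2 * (1 + ‖v‖ ^ 2 + c ^ 2) := by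
    rw [← hts]; ring
  nlinarith [mul_pos ht (sub_pos.2 hlt), pow_pos ht 2]

/-- **Corollary 1.** If the linearly separable points `x i`, `y j` lie near an affine
subspace, in the sense that `⟪r k, x i⟫ ≥ Δ k ≥ ⟪r k, y j⟫` for an orthonormal family `r`
and nonnegative scalars `Δ k`, and `(w̄, B)` with `B ≥ 0` is the minimizer of `‖w‖² + b²`
subject to `⟪w, x i⟫ + b ≥ 1` and `⟪w, y j⟫ + b ≤ -1`, then `‖w̄‖² ≥ B² ∑ₖ Δₖ²`;
i.e. the margin `1/‖w̄‖` is at most `1/√(B² ∑ₖ Δₖ²)`. -/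
theorem cross_entropy_near_subspace_poor_margin
    {d : ℕ} {I J K : Type*} [Fintype I] [Fintype J] [Fintype K]
    [Nonempty I] [Nonempty J] [Nonempty K]
    (x : I → EuclideanSpace ℝ (Fin d)) (y : J → EuclideanSpace ℝ (Fin d))
    (hsep : ∃ (w : EuclideanSpace ℝ (Fin d)) (b : ℝ),
      (∀ i, 0 < ⟪w, x i⟫ + b) ∧ (∀ j, ⟪w, y j⟫ + b < 0))
    (r : K → EuclideanSpace ℝ (Fin d)) (hr : Orthonormal ℝ r)
    (Δ : K → ℝ) (hΔ : ∀ k, 0 ≤ Δ k)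
    (hxr : ∀ k i, Δ k ≤ ⟪r k, x i⟫)
    (hyr : ∀ k j, ⟪r k, y j⟫ ≤ Δ k)
    (wbar : EuclideanSpace ℝ (Fin d)) (B : ℝ) (hB : 0 ≤ B)
    (hfeas₁ : ∀ i, 1 ≤ ⟪wbar, x i⟫ + B)
    (hfeas₂ : ∀ j, ⟪wbar, y j⟫ + B ≤ -1)
    (hmin : ∀ (w : EuclideanSpace ℝ (Fin d)) (b : ℝ),
      (∀ i, 1 ≤ ⟪w, x i⟫ + b) → (∀ j, ⟪w, y j⟫ + b ≤ -1) →
      ‖wbar‖ ^ 2 + B ^ 2 ≤ ‖w‖ ^ 2 + b ^ 2) :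
    B ^ 2 * ∑ k, (Δ k) ^ 2 ≤ ‖wbar‖ ^ 2 := by
  have key : ∀ k, B * Δ k ≤ ⟪r k, wbar⟫ := fun k ↦
    mul_le_inner_of_norm_sq_add_sq_le fun t ht ↦ hmin _ _
      (fun i ↦ by
        rw [inner_add_left, real_inner_smul_left]
        linarith [hfeas₁ i, mul_le_mul_of_nonneg_left (hxr k i) ht])
      (fun j ↦ by
        rw [inner_add_left, real_inner_smul_left]
        linarith [hfeas₂ j, mul_le_mul_of_nonneg_left (hyr k j) ht])
  calc B ^ 2 * ∑ k, (Δ k) ^ 2 = ∑ k, (B * Δ k) ^ 2 := by simp only [Finset.mul_sum, mul_pow]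
    _ ≤ ∑ k, ‖⟪r k, wbar⟫‖ ^ 2 := Finset.sum_le_sum fun k _ ↦
        pow_le_pow_left₀ (mul_nonneg hB (hΔ k)) ((key k).trans (Real.le_norm_self _)) 2
    _ ≤ ‖wbar‖ ^ 2 := hr.sum_inner_products_le wbar
end

section
/- Let {x_i}_{i∈I} and {y_j}_{j∈J} be finite families of points in ℝ^d, and suppose there exist a finite orthonormal family {r_k}_{k∈K} in ℝ^d and scalars {Δ_k}_{k∈K} such that ⟨r_k, x_i⟩ = ⟨r_k, y_j⟩ = Δ_k for all i∈I, j∈J, k∈K. If (w̄, B) ∈ ℝ^d × ℝ is a minimizer of ‖w‖² + b² over all (w, b) satisfying ⟨w, x_i⟩ + b ≥ 1 for all i∈I and ⟨w, y_j⟩ + b ≤ −1 for all j∈J (assuming a feasible point exists), then ⟨w̄, r_k⟩ = B · Δ_k for every k∈K. -/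
open scoped RealInnerProductSpace

/-- (KKT step in the proof of Theorem 1.) If the points `x i`, `y j` lie on the affine
subspace `⟪r k, ·⟫ = Δ k` for an orthonormal family `r`, and `(w̄, B)` is a minimizer of
`‖w‖² + b²` subject to `⟪w, x i⟫ + b ≥ 1` and `⟪w, y j⟫ + b ≤ -1`, then
`⟪w̄, r k⟫ = B · Δ k` for every `k`. -/
theorem minimizer_inner_eq_of_affine_subspace
    {d : ℕ} {I J K : Type*} [Fintype I] [Fintype J] [Fintype K]
    [Nonempty I] [Nonempty J] [Nonempty K]
    (x : I → EuclideanSpace ℝ (Fin d)) (y : J → EuclideanSpace ℝ (Fin d))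
    (r : K → EuclideanSpace ℝ (Fin d)) (hr : Orthonormal ℝ r)
    (Δ : K → ℝ)
    (hxr : ∀ k i, ⟪r k, x i⟫ = Δ k)
    (hyr : ∀ k j, ⟪r k, y j⟫ = Δ k)
    (wbar : EuclideanSpace ℝ (Fin d)) (B : ℝ)
    (hfeas₁ : ∀ i, 1 ≤ ⟪wbar, x i⟫ + B)
    (hfeas₂ : ∀ j, ⟪wbar, y j⟫ + B ≤ -1)
    (hmin : ∀ (w : EuclideanSpace ℝ (Fin d)) (b : ℝ),
      (∀ i, 1 ≤ ⟪w, x i⟫ + b) → (∀ j, ⟪w, y j⟫ + b ≤ -1) →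
      ‖wbar‖ ^ 2 + B ^ 2 ≤ ‖w‖ ^ 2 + b ^ 2) :
    ∀ k, ⟪wbar, r k⟫ = B * Δ k := by
  intro k
  set c : ℝ := ⟪wbar, r k⟫ - B * Δ k with hc
  have hpos : 0 < 1 + Δ k ^ 2 := by positivity
  have hperturb : ∀ t : ℝ, 0 ≤ 2 * t * c + t ^ 2 * (1 + Δ k ^ 2) := by
    intro t
    have h := hmin (wbar + t • r k) (B - t * Δ k)
      (fun i => by
        rw [inner_add_left, real_inner_smul_left, hxr]
        linarith [hfeas₁ i])
      (fun j => by
        rw [inner_add_left, real_inner_smul_left, hyr]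
        linarith [hfeas₂ j])
    rw [norm_add_sq_real, real_inner_smul_right, norm_smul, hr.1 k, mul_one,
      Real.norm_eq_abs, sq_abs] at h
    rw [hc]
    linarith
  have h := hperturb (-c / (1 + Δ k ^ 2))
  have hvalue : 2 * (-c / (1 + Δ k ^ 2)) * c + (-c / (1 + Δ k ^ 2)) ^ 2 * (1 + Δ k ^ 2)
      = -(c ^ 2 / (1 + Δ k ^ 2)) := by
    field_simp
    ring
  rw [hvalue, Left.nonneg_neg_iff, div_le_iff₀ hpos, zero_mul] at h
  exact sub_eq_zero.mp (pow_eq_zero_iff two_ne_zero |>.mp (le_antisymm h (sq_nonneg c)))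
end

section
/- Let {x_i}_{i∈I} and {y_j}_{j∈J} be finite families of points in ℝ^d, and suppose there exist a finite orthonormal family {r_k}_{k∈K} in ℝ^d and scalars {Δ_k}_{k∈K} such that ⟨r_k, x_i⟩ ≥ Δ_k and ⟨r_k, y_j⟩ ≤ Δ_k for all i∈I, j∈J, k∈K. If (w̄, B) ∈ ℝ^d × ℝ is a minimizer of ‖w‖² + b² over all (w, b) satisfying ⟨w, x_i⟩ + b ≥ 1 for all i∈I and ⟨w, y_j⟩ + b ≤ −1 for all j∈J (assuming a feasible point exists), then ⟨w̄, r_k⟩ ≥ B · Δ_k for every k∈K. -/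
open scoped RealInnerProductSpace

/-- (KKT step in the proof of Corollary 1.) If `⟪r k, x i⟫ ≥ Δ k ≥ ⟪r k, y j⟫` for an
orthonormal family `r`, and `(w̄, B)` is a minimizer of `‖w‖² + b²` subject to
`⟪w, x i⟫ + b ≥ 1` and `⟪w, y j⟫ + b ≤ -1`, then `⟪w̄, r k⟫ ≥ B · Δ k` for every `k`. -/
theorem minimizer_inner_ge_of_near_subspace
    {d : ℕ} {I J K : Type*} [Fintype I] [Fintype J] [Fintype K]
    [Nonempty I] [Nonempty J] [Nonempty K]
    (x : I → EuclideanSpace ℝ (Fin d)) (y : J → EuclideanSpace ℝ (Fin d))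
    (r : K → EuclideanSpace ℝ (Fin d)) (hr : Orthonormal ℝ r)
    (Δ : K → ℝ)
    (hxr : ∀ k i, Δ k ≤ ⟪r k, x i⟫)
    (hyr : ∀ k j, ⟪r k, y j⟫ ≤ Δ k)
    (wbar : EuclideanSpace ℝ (Fin d)) (B : ℝ)
    (hfeas₁ : ∀ i, 1 ≤ ⟪wbar, x i⟫ + B)
    (hfeas₂ : ∀ j, ⟪wbar, y j⟫ + B ≤ -1)
    (hmin : ∀ (w : EuclideanSpace ℝ (Fin d)) (b : ℝ),
      (∀ i, 1 ≤ ⟪w, x i⟫ + b) → (∀ j, ⟪w, y j⟫ + b ≤ -1) →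
      ‖wbar‖ ^ 2 + B ^ 2 ≤ ‖w‖ ^ 2 + b ^ 2) :
    ∀ k, B * Δ k ≤ ⟪wbar, r k⟫ := by
  intro k
  by_contra! h
  set s := B * Δ k - ⟪wbar, r k⟫ with hs
  have hs_pos : 0 < s := sub_pos.mpr h
  have hc_pos : 0 < 1 + Δ k ^ 2 := by positivity
  obtain ⟨t, ht⟩ : ∃ t, t * (1 + Δ k ^ 2) = s := ⟨s / (1 + Δ k ^ 2), by field_simp⟩
  have ht_pos : 0 < t := pos_of_mul_pos_left (ht ▸ hs_pos) hc_pos.le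
  have key := hmin (wbar + t • r k) (B - t * Δ k)
    (fun i => by
      rw [inner_add_left, real_inner_smul_left]
      linarith [hfeas₁ i, mul_le_mul_of_nonneg_left (hxr k i) ht_pos.le])
    (fun j => by
      rw [inner_add_left, real_inner_smul_left]
      linarith [hfeas₂ j, mul_le_mul_of_nonneg_left (hyr k j) ht_pos.le])
  rw [norm_add_sq_real, norm_smul, hr.norm_eq_one k, mul_one, Real.norm_eq_abs, sq_abs,
    real_inner_smul_right] at key
  have decrease : t * s ≤ 0 := by
    linear_combination key + t * ht - 2 * t * hs
  exact absurd (mul_pos ht_pos hs_pos) decrease.not_gt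
end

section
/- Let {x_i}_{i∈I} and {y_j}_{j∈J} be finite families of points in ℝ^d that are linearly separable. For i∈I let x̃_i = (x_i, 1) ∈ ℝ^{d+1} and for j∈J let ỹ_j = (y_j, 1) ∈ ℝ^{d+1}. Define the cross-entropy (logistic) loss L(z) = Σ_{i∈I} log(1 + exp(−⟨z, x̃_i⟩)) + Σ_{j∈J} log(1 + exp(⟨z, ỹ_j⟩)) for z ∈ ℝ^{d+1}. There exists η₀ > 0 such that for every step size η ∈ (0, η₀) and every initialization z(0) ∈ ℝ^{d+1}, the gradient descent iterates z(t+1) = z(t) − η∇L(z(t)) satisfy lim_{t→∞} z(t)/‖z(t)‖ = w̄/‖w̄‖, where w̄ is the unique minimizer of ‖z‖² over all z ∈ ℝ^{d+1} satisfying ⟨z, x̃_i⟩ ≥ 1 for all i∈I and ⟨z, ỹ_j⟩ ≤ −1 for all j∈J. -/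
open scoped RealInnerProductSpace

/-- The logistic loss `∑ₖ log (1 + exp (-⟪z, vₖ⟫))` of a linear classifier `z` on the vectors
`vₖ`, which carry their labels as signs. -/
noncomputable def logisticLoss {E K : Type*} [NormedAddCommGroup E] [InnerProductSpace ℝ E]
    [Fintype K] (v : K → E) (z : E) : ℝ :=
  ∑ k, Real.log (1 + Real.exp (-⟪z, v k⟫))

/-- The total weight `∑ₖ sigmoid (-⟪z, vₖ⟫)` of the vectors in the negative gradient of the
logistic loss. -/
noncomputable def logisticWeight {E K : Type*} [NormedAddCommGroup E] [InnerProductSpace ℝ E]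
    [Fintype K] (v : K → E) (z : E) : ℝ :=
  ∑ k, Real.sigmoid (-⟪z, v k⟫)

/-- The negative gradient of the logistic loss. -/
noncomputable def logisticStep {E K : Type*} [NormedAddCommGroup E] [InnerProductSpace ℝ E]
    [Fintype K] (v : K → E) (z : E) : E :=
  ∑ k, Real.sigmoid (-⟪z, v k⟫) • v k

lemma one_add_exp_neg_mul_sigmoid_neg (m : ℝ) :
    (1 + Real.exp (-m)) * Real.sigmoid (-m) = Real.exp (-m) := by
  rw [Real.sigmoid_def, neg_neg, Real.exp_neg]
  have := Real.exp_pos m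
  field_simp
  ring

lemma log_one_add_exp_neg_add_le (m : ℝ) {δ : ℝ} (hδ : |δ| ≤ 1) :
    Real.log (1 + Real.exp (-(m + δ))) ≤
      Real.log (1 + Real.exp (-m)) - Real.sigmoid (-m) * δ + Real.sigmoid (-m) * δ ^ 2 := by
  have hm := Real.exp_pos (-m)
  have hpos : 0 < 1 + Real.exp (-m) := by positivity
  have hσ := Real.sigmoid_pos (x := -m)
  have hmul := one_add_exp_neg_mul_sigmoid_neg m
  have hexp : Real.exp (-δ) - 1 ≤ -δ + δ ^ 2 := by
    have h := (abs_le.1 (Real.abs_exp_sub_one_sub_id_le (x := -δ) (by rwa [abs_neg]))).2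
    nlinarith
  have hfac : 1 + Real.exp (-(m + δ)) =
      (1 + Real.exp (-m)) * (1 + Real.sigmoid (-m) * (Real.exp (-δ) - 1)) := by
    rw [neg_add, Real.exp_add]
    linear_combination (-(Real.exp (-δ) - 1)) * hmul
  have hfpos : 0 < 1 + Real.sigmoid (-m) * (Real.exp (-δ) - 1) := by
    have : 0 < 1 + Real.exp (-(m + δ)) := by positivity
    rw [hfac] at this
    exact pos_of_mul_pos_right this hpos.le
  rw [hfac, Real.log_mul hpos.ne' hfpos.ne']
  have := Real.log_le_sub_one_of_pos hfpos
  nlinarith [mul_le_mul_of_nonneg_left hexp hσ.le]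

section

variable {E K : Type*} [NormedAddCommGroup E] [InnerProductSpace ℝ E]

/-- The variational inequality for a vector of minimal norm in a convex set. -/
lemma Convex.norm_sq_le_inner_of_forall_norm_sq_le {C : Set E} (hC : Convex ℝ C) {w : E}
    (hw : w ∈ C) (hmin : ∀ u ∈ C, ‖w‖ ^ 2 ≤ ‖u‖ ^ 2) {u : E} (hu : u ∈ C) :
    ‖w‖ ^ 2 ≤ ⟪w, u⟫ := by
  by_contra! hlt
  have hp : ⟪w, u - w⟫ < 0 := by
    rw [inner_sub_right, real_inner_self_eq_norm_sq]
    linarith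
  have hs : ∀ s : ℝ, 0 < s → s ≤ 1 → 0 ≤ 2 * ⟪w, u - w⟫ + s * ‖u - w‖ ^ 2 := by
    intro s hs0 hs1
    have h := hmin _ (hC.add_smul_sub_mem hw hu ⟨hs0.le, hs1⟩)
    rw [norm_add_sq_real, real_inner_smul_right, norm_smul, Real.norm_of_nonneg hs0.le] at h
    have : 0 ≤ s * (2 * ⟪w, u - w⟫ + s * ‖u - w‖ ^ 2) := by nlinarith
    exact nonneg_of_mul_nonneg_right this hs0
  have hlim : Filter.Tendsto (fun s : ℝ => 2 * ⟪w, u - w⟫ + s * ‖u - w‖ ^ 2)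
      (nhdsWithin 0 (Set.Ioi 0)) (nhds (2 * ⟪w, u - w⟫ + 0 * ‖u - w‖ ^ 2)) :=
    (Continuous.tendsto (by fun_prop) 0).mono_left nhdsWithin_le_nhds
  have := ge_of_tendsto hlim (by
    filter_upwards [Ioc_mem_nhdsGT (zero_lt_one (α := ℝ))] with s hs'
    exact hs s hs'.1 hs'.2)
  linarith

/-- If every margin of `z` relative to `‖z‖` asymptotically exceeds every `c` below the maximal
margin `‖w‖⁻¹`, then `z` converges in direction to the maximal margin vector `w`. -/
lemma tendsto_direction_of_margin [Nonempty K] {α : Type*} {l : Filter α} {v : K → E} {w : E}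
    (hw : ∀ k, 1 ≤ ⟪w, v k⟫) (hmin : ∀ u, (∀ k, 1 ≤ ⟪u, v k⟫) → ‖w‖ ^ 2 ≤ ‖u‖ ^ 2)
    {z : α → E} (hz : ∀ᶠ t in l, 0 < ‖z t‖)
    (hmargin : ∀ c : ℝ, 0 < c → c * ‖w‖ < 1 → ∀ᶠ t in l, ∀ k, c * ‖z t‖ ≤ ⟪z t, v k⟫) :
    Filter.Tendsto (fun t => ‖z t‖⁻¹ • z t) l (nhds (‖w‖⁻¹ • w)) := by
  have hw0 : 0 < ‖w‖ := norm_pos_iff.2 fun h => by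
    obtain ⟨k⟩ := ‹Nonempty K›
    have := hw k
    simp [h] at this
    linarith
  have hC : Convex ℝ {u : E | ∀ k, 1 ≤ ⟪u, v k⟫} := by
    intro a ha b hb p q hp hq hpq k
    rw [inner_add_left, real_inner_smul_left, real_inner_smul_left]
    nlinarith [mul_le_mul_of_nonneg_left (ha k) hp, mul_le_mul_of_nonneg_left (hb k) hq]
  have hinner : Filter.Tendsto (fun t => ⟪‖z t‖⁻¹ • z t, ‖w‖⁻¹ • w⟫) l (nhds 1) := by
    refine tendsto_order.2 ⟨fun a ha => ?_, fun a ha => ?_⟩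
    · obtain ⟨b, hb, hb1⟩ := exists_between (max_lt ha zero_lt_one)
      have hb0 : 0 < b := (le_max_right _ _).trans_lt hb
      have hab : a < b := (le_max_left _ _).trans_lt hb
      filter_upwards [hz, hmargin (b / ‖w‖) (by positivity) (by field_simp; exact hb1)]
        with t ht hm
      have hmem : (‖w‖ / (b * ‖z t‖)) • z t ∈ {u : E | ∀ k, 1 ≤ ⟪u, v k⟫} := fun k => by
        have := hm k
        rw [real_inner_smul_left, div_mul_eq_mul_div, one_le_div (by positivity)]
        rw [div_mul_eq_mul_div, div_le_iff₀ hw0] at this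
        linarith
      have h := hC.norm_sq_le_inner_of_forall_norm_sq_le hw hmin hmem
      rw [real_inner_smul_right, div_mul_eq_mul_div, le_div_iff₀ (by positivity)] at h
      have h2 : b * (‖z t‖ * ‖w‖) ≤ ⟪w, z t⟫ :=
        le_of_mul_le_mul_left (by linarith) hw0
      rw [real_inner_smul_left, real_inner_smul_right, real_inner_comm]
      refine hab.trans_le ?_
      rw [← mul_assoc, ← mul_inv, inv_mul_eq_div, le_div_iff₀ (by positivity)]
      exact h2
    · filter_upwards [hz] with t ht
      refine lt_of_le_of_lt ((real_inner_le_norm _ _).trans_eq ?_) ha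
      simp [norm_smul, ht.ne', hw0.ne']
  rw [tendsto_iff_norm_sub_tendsto_zero]
  have hsq : Filter.Tendsto (fun t => ‖‖z t‖⁻¹ • z t - ‖w‖⁻¹ • w‖ ^ 2) l (nhds 0) := by
    have h : Filter.Tendsto (fun t => 2 - 2 * ⟪‖z t‖⁻¹ • z t, ‖w‖⁻¹ • w⟫) l (nhds 0) := by
      simpa using (hinner.const_mul 2).const_sub 2
    refine h.congr' ?_
    filter_upwards [hz] with t ht
    rw [norm_sub_sq_real]
    simp only [norm_smul, norm_inv, norm_norm, inv_mul_cancel₀ ht.ne', inv_mul_cancel₀ hw0.ne']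
    ring
  simpa [Real.sqrt_sq] using hsq.sqrt

variable [Fintype K]

lemma hasGradientAt_logisticLoss [CompleteSpace E] (v : K → E) (z : E) :
    HasGradientAt (logisticLoss v) (-logisticStep v z) z := by
  rw [hasGradientAt_iff_hasFDerivAt]
  have hk : ∀ k ∈ Finset.univ, HasFDerivAt (fun z : E => Real.log (1 + Real.exp (-⟪z, v k⟫)))
      ((1 + Real.exp (-⟪z, v k⟫))⁻¹ • (Real.exp (-⟪z, v k⟫) • -(innerSL ℝ (v k)))) z := by
    intro k _
    have h1 : HasFDerivAt (fun z : E => ⟪z, v k⟫) (innerSL ℝ (v k)) z := by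
      convert (innerSL ℝ (v k)).hasFDerivAt (x := z) using 2
      exact real_inner_comm _ _
    exact (h1.neg.exp.const_add 1).log (by positivity)
  have hsum : InnerProductSpace.toDual ℝ E (-logisticStep v z) = ∑ k,
      (1 + Real.exp (-⟪z, v k⟫))⁻¹ • (Real.exp (-⟪z, v k⟫) • -(innerSL ℝ (v k))) := by
    ext u
    rw [map_neg, logisticStep]
    simp only [neg_apply, InnerProductSpace.toDual_apply_apply, sum_inner, real_inner_smul_left,
      sum_apply, smul_apply, innerSL_apply_apply, ← Finset.sum_neg_distrib, smul_eq_mul]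
    refine Finset.sum_congr rfl fun k _ => ?_
    have hpos : 1 + Real.exp (-⟪z, v k⟫) ≠ 0 := by positivity
    have hmul := one_add_exp_neg_mul_sigmoid_neg ⟪z, v k⟫
    field_simp
    linear_combination (-⟪v k, u⟫) * hmul
  rw [hsum]
  exact HasFDerivAt.fun_sum hk

lemma logisticWeight_nonneg (v : K → E) (z : E) : 0 ≤ logisticWeight v z :=
  Finset.sum_nonneg fun _ _ => (Real.sigmoid_nonneg _)

lemma logisticWeight_le_card (v : K → E) (z : E) : logisticWeight v z ≤ Fintype.card K := by
  calc logisticWeight v z ≤ ∑ _k : K, (1 : ℝ) :=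
        Finset.sum_le_sum fun _ _ => Real.sigmoid_le_one _
    _ = Fintype.card K := by simp

lemma logisticLoss_pos [Nonempty K] (v : K → E) (z : E) : 0 < logisticLoss v z :=
  Finset.sum_pos (fun k _ => Real.log_pos (by linarith [Real.exp_pos (-⟪z, v k⟫)]))
    Finset.univ_nonempty

lemma norm_logisticStep_le {v : K → E} {R : ℝ} (hR : ∀ k, ‖v k‖ ≤ R) (z : E) :
    ‖logisticStep v z‖ ≤ R * logisticWeight v z := by
  rw [logisticWeight, Finset.mul_sum]
  refine norm_sum_le_of_le _ fun k _ => ?_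
  rw [norm_smul, Real.norm_of_nonneg (Real.sigmoid_nonneg _), mul_comm]
  exact mul_le_mul_of_nonneg_right (hR k) (Real.sigmoid_nonneg _)

lemma logisticWeight_le_norm_mul_norm_logisticStep {v : K → E} {w : E}
    (hw : ∀ k, 1 ≤ ⟪w, v k⟫) (z : E) :
    logisticWeight v z ≤ ‖w‖ * ‖logisticStep v z‖ := by
  refine le_trans ?_ (real_inner_le_norm w (logisticStep v z))
  rw [logisticStep, inner_sum]
  refine Finset.sum_le_sum fun k _ => ?_
  rw [inner_smul_right]
  exact le_mul_of_one_le_right (Real.sigmoid_nonneg _) (hw k)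

/-- The descent inequality, with a second order term proportional to the total weight. -/
lemma logisticLoss_add_smul_logisticStep_le {v : K → E} {R : ℝ} (hR0 : 0 ≤ R)
    (hR : ∀ k, ‖v k‖ ≤ R) {η : ℝ} (hη : 0 ≤ η) (hηR : η * (R ^ 2 * Fintype.card K) ≤ 1) (z : E) :
    logisticLoss v (z + η • logisticStep v z) ≤ logisticLoss v z -
      η * (1 - η * R ^ 2 * logisticWeight v z) * ‖logisticStep v z‖ ^ 2 := by
  set g := logisticStep v z with hg
  have hgR : ‖g‖ ≤ R * Fintype.card K := (norm_logisticStep_le hR z).trans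
    (mul_le_mul_of_nonneg_left (logisticWeight_le_card v z) hR0)
  have hδ : ∀ k, |η * ⟪g, v k⟫| ≤ η * (‖g‖ * R) := fun k => by
    rw [abs_mul, abs_of_nonneg hη]
    gcongr
    exact (abs_real_inner_le_norm _ _).trans (by gcongr; exact hR k)
  have hδ1 : ∀ k, |η * ⟪g, v k⟫| ≤ 1 := fun k => by
    refine (hδ k).trans (le_trans ?_ hηR)
    have := mul_le_mul_of_nonneg_right hgR hR0
    exact mul_le_mul_of_nonneg_left (by linarith) hη
  have hterm : ∀ k ∈ Finset.univ, Real.log (1 + Real.exp (-⟪z + η • g, v k⟫)) ≤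
      Real.log (1 + Real.exp (-⟪z, v k⟫)) - η * (Real.sigmoid (-⟪z, v k⟫) * ⟪g, v k⟫)
        + Real.sigmoid (-⟪z, v k⟫) * (η * (‖g‖ * R)) ^ 2 := fun k _ => by
    rw [inner_add_left, real_inner_smul_left]
    refine (log_one_add_exp_neg_add_le _ (hδ1 k)).trans ?_
    have hsq : (η * ⟪g, v k⟫) ^ 2 ≤ (η * (‖g‖ * R)) ^ 2 := by
      rw [← sq_abs]
      gcongr
      exact hδ k
    nlinarith [mul_le_mul_of_nonneg_left hsq (Real.sigmoid_nonneg (-⟪z, v k⟫))]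
  have hinner : ∑ k, Real.sigmoid (-⟪z, v k⟫) * ⟪g, v k⟫ = ‖g‖ ^ 2 := by
    rw [← real_inner_self_eq_norm_sq]
    conv_rhs => rw [hg, logisticStep, inner_sum]
    rw [← logisticStep, ← hg]
    exact Finset.sum_congr rfl fun k _ => (real_inner_smul_right _ _ _).symm
  refine (Finset.sum_le_sum hterm).trans_eq ?_
  rw [Finset.sum_add_distrib, Finset.sum_sub_distrib, ← Finset.mul_sum, ← Finset.sum_mul, hinner,
    ← logisticLoss, ← logisticWeight]
  ring

section iterates

variable {v : K → E} {R η : ℝ} {z : ℕ → E} {w : E}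

/-- For a small step size the total weight tends to zero along gradient descent. -/
lemma tendsto_logisticWeight_zero [Nonempty K] (hR0 : 0 ≤ R) (hR : ∀ k, ‖v k‖ ≤ R) (hη : 0 < η)
    (hηR : η * (R ^ 2 * Fintype.card K) ≤ 1 / 2)
    (hz : ∀ t, z (t + 1) = z t + η • logisticStep v (z t)) (hw : ∀ k, 1 ≤ ⟪w, v k⟫) :
    Filter.Tendsto (fun t => logisticWeight v (z t)) Filter.atTop (nhds 0) := by
  have hdesc : ∀ t, logisticLoss v (z (t + 1)) + η / 2 * ‖logisticStep v (z t)‖ ^ 2 ≤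
      logisticLoss v (z t) := fun t => by
    have h := logisticLoss_add_smul_logisticStep_le hR0 hR hη.le (by linarith) (z t)
    rw [← hz] at h
    have hG : η * R ^ 2 * logisticWeight v (z t) ≤ 1 / 2 := by
      refine le_trans ?_ hηR
      rw [← mul_assoc]
      exact mul_le_mul_of_nonneg_left (logisticWeight_le_card v _) (by positivity)
    have : 0 ≤ η * ‖logisticStep v (z t)‖ ^ 2 := by positivity
    nlinarith [mul_le_mul_of_nonneg_left hG this]
  have hsum : ∀ n, ∑ t ∈ Finset.range n, η / 2 * ‖logisticStep v (z t)‖ ^ 2 ≤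
      logisticLoss v (z 0) - logisticLoss v (z n) := fun n => by
    induction n with
    | zero => simp
    | succ n ih =>
      rw [Finset.sum_range_succ]
      linarith [hdesc n]
  have hsummable : Summable fun t => η / 2 * ‖logisticStep v (z t)‖ ^ 2 :=
    summable_of_sum_range_le (c := logisticLoss v (z 0)) (fun t => by positivity)
      fun n => (hsum n).trans (sub_le_self _ (logisticLoss_pos v _).le)
  have hstep : Filter.Tendsto (fun t => ‖logisticStep v (z t)‖) Filter.atTop (nhds 0) := by
    have h := ((hsummable.tendsto_atTop_zero).const_mul (2 / η)).sqrt
    simp only [mul_zero, Real.sqrt_zero] at h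
    refine h.congr fun t => ?_
    rw [← mul_assoc, show 2 / η * (η / 2) = 1 by field_simp, one_mul, Real.sqrt_sq (norm_nonneg _)]
  refine squeeze_zero (fun t => logisticWeight_nonneg v _)
    (fun t => logisticWeight_le_norm_mul_norm_logisticStep hw (z t)) ?_
  simpa using hstep.const_mul ‖w‖

lemma tendsto_exp_neg_margin_zero
    (hG : Filter.Tendsto (fun t => logisticWeight v (z t)) Filter.atTop (nhds 0)) (k : K) :
    Filter.Tendsto (fun t => Real.exp (-⟪z t, v k⟫)) Filter.atTop (nhds 0) := by
  have hσ : Filter.Tendsto (fun t => Real.sigmoid (-⟪z t, v k⟫)) Filter.atTop (nhds 0) :=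
    squeeze_zero (fun t => (Real.sigmoid_nonneg _)) (fun t => Finset.single_le_sum
      (f := fun k => Real.sigmoid (-⟪z t, v k⟫)) (fun _ _ => (Real.sigmoid_nonneg _))
      (Finset.mem_univ k)) hG
  have h := hσ.div (hσ.const_sub 1) (by norm_num)
  simp only [zero_div] at h
  refine h.congr fun t => ?_
  have h1 : 0 < 1 - Real.sigmoid (-⟪z t, v k⟫) := sub_pos.2 (Real.sigmoid_lt_one _)
  have := one_add_exp_neg_mul_sigmoid_neg ⟪z t, v k⟫
  simp only [Pi.div_apply]
  rw [div_eq_iff h1.ne']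
  linarith

lemma tendsto_norm_atTop [Nonempty K]
    (hG : Filter.Tendsto (fun t => logisticWeight v (z t)) Filter.atTop (nhds 0)) :
    Filter.Tendsto (fun t => ‖z t‖) Filter.atTop Filter.atTop := by
  obtain ⟨k⟩ := ‹Nonempty K›
  have hm : Filter.Tendsto (fun t => ⟪z t, v k⟫) Filter.atTop Filter.atTop := by
    have h := tendsto_exp_neg_margin_zero hG k
    rw [Real.tendsto_exp_comp_nhds_zero] at h
    simpa [Function.comp_def] using Filter.tendsto_neg_atBot_atTop.comp h
  refine Filter.Tendsto.atTop_of_mul_const₀ (c := ‖v k‖ + 1) (by positivity)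
    (Filter.tendsto_atTop_mono (fun t => ?_) hm)
  nlinarith [real_inner_le_norm (z t) (v k), norm_nonneg (z t)]

/-- Eventually `log L + c ‖z‖` decreases along gradient descent, for `c` below the maximal
margin. -/
lemma eventually_log_logisticLoss_add_le [Nonempty K] (hR0 : 0 ≤ R) (hR : ∀ k, ‖v k‖ ≤ R)
    (hη : 0 < η) (hηR : η * (R ^ 2 * Fintype.card K) ≤ 1 / 2)
    (hz : ∀ t, z (t + 1) = z t + η • logisticStep v (z t)) (hw : ∀ k, 1 ≤ ⟪w, v k⟫)
    {c : ℝ} (hc : 0 < c) (hcw : c * ‖w‖ < 1) :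
    ∀ᶠ t in Filter.atTop, Real.log (logisticLoss v (z (t + 1))) + c * ‖z (t + 1)‖ ≤
      Real.log (logisticLoss v (z t)) + c * ‖z t‖ := by
  have hG := tendsto_logisticWeight_zero hR0 hR hη hηR hz hw
  have hev : ∀ᶠ t in Filter.atTop, ∀ k, c * ‖w‖ * (1 + Real.exp (-⟪z t, v k⟫)) <
      1 - η * R ^ 2 * logisticWeight v (z t) := by
    refine Filter.eventually_all.2 fun k => ?_
    have h1 := ((tendsto_exp_neg_margin_zero hG k).const_add 1).const_mul (c * ‖w‖)
    have h2 := (hG.const_mul (η * R ^ 2)).const_sub 1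
    exact h1.eventually_lt h2 (by simpa using hcw)
  filter_upwards [hev] with t ht
  set g := logisticStep v (z t)
  set G := logisticWeight v (z t) with hGdef
  set A := logisticLoss v (z t) with hA
  set B := 1 - η * R ^ 2 * G
  have hApos : 0 < A := logisticLoss_pos v _
  have hBpos : 0 < B := by
    obtain ⟨k⟩ := ‹Nonempty K›
    exact lt_of_le_of_lt (by positivity) (ht k)
  have hwg : G ≤ ‖w‖ * ‖g‖ := logisticWeight_le_norm_mul_norm_logisticStep hw _
  have hw0 : 0 < ‖w‖ := norm_pos_iff.2 fun h => by
    obtain ⟨k⟩ := ‹Nonempty K›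
    have := hw k
    simp [h] at this
    linarith
  have hAG : c * ‖w‖ * A ≤ B * G := by
    rw [hA, hGdef, logisticLoss, logisticWeight, Finset.mul_sum, Finset.mul_sum]
    refine Finset.sum_le_sum fun k _ => ?_
    have h1 := Real.log_le_sub_one_of_pos (x := 1 + Real.exp (-⟪z t, v k⟫)) (by positivity)
    calc c * ‖w‖ * Real.log (1 + Real.exp (-⟪z t, v k⟫))
        ≤ c * ‖w‖ * ((1 + Real.exp (-⟪z t, v k⟫)) * Real.sigmoid (-⟪z t, v k⟫)) := by
          rw [one_add_exp_neg_mul_sigmoid_neg]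
          gcongr
          linarith
      _ ≤ B * Real.sigmoid (-⟪z t, v k⟫) := by
          rw [← mul_assoc]
          exact mul_le_mul_of_nonneg_right (ht k).le (Real.sigmoid_nonneg _)
  have hcA : c * A ≤ B * ‖g‖ := by
    have : ‖w‖ * (c * A) ≤ ‖w‖ * (B * ‖g‖) := by
      nlinarith [mul_le_mul_of_nonneg_left hwg hBpos.le]
    exact le_of_mul_le_mul_left this hw0
  have hdesc : logisticLoss v (z (t + 1)) ≤ A * (1 - c * (η * ‖g‖)) := by
    have h := logisticLoss_add_smul_logisticStep_le hR0 hR hη.le (by linarith) (z t)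
    rw [← hz] at h
    have : 0 ≤ η * ‖g‖ := by positivity
    calc _ ≤ A - η * B * ‖g‖ ^ 2 := h
      _ ≤ _ := by nlinarith [mul_le_mul_of_nonneg_left hcA this]
  have hpos : 0 < 1 - c * (η * ‖g‖) :=
    pos_of_mul_pos_right ((logisticLoss_pos v _).trans_le hdesc) hApos.le
  have hlog : Real.log (logisticLoss v (z (t + 1))) ≤ Real.log A - c * (η * ‖g‖) := by
    refine (Real.log_le_log (logisticLoss_pos v _) hdesc).trans ?_
    rw [Real.log_mul hApos.ne' hpos.ne']
    linarith [Real.log_le_sub_one_of_pos hpos]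
  have hnorm : ‖z (t + 1)‖ ≤ ‖z t‖ + η * ‖g‖ := by
    rw [hz]
    refine (norm_add_le _ _).trans_eq ?_
    rw [norm_smul, Real.norm_of_nonneg hη.le]
  nlinarith [mul_le_mul_of_nonneg_left hnorm hc.le]

/-- The normalized margins of gradient descent asymptotically exceed every `c` below the maximal
margin. -/
lemma eventually_mul_norm_le_margin [Nonempty K] (hR0 : 0 ≤ R) (hR : ∀ k, ‖v k‖ ≤ R)
    (hη : 0 < η) (hηR : η * (R ^ 2 * Fintype.card K) ≤ 1 / 2)
    (hz : ∀ t, z (t + 1) = z t + η • logisticStep v (z t)) (hw : ∀ k, 1 ≤ ⟪w, v k⟫)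
    {c : ℝ} (hc : 0 < c) (hcw : c * ‖w‖ < 1) :
    ∀ᶠ t in Filter.atTop, ∀ k, c * ‖z t‖ ≤ ⟪z t, v k⟫ := by
  have hG := tendsto_logisticWeight_zero hR0 hR hη hηR hz hw
  obtain ⟨c', hcc', hc'w⟩ : ∃ c', c < c' ∧ c' * ‖w‖ < 1 :=
    (((continuous_mul_const ‖w‖).tendsto c).eventually_lt_const hcw |>.filter_mono
      nhdsWithin_le_nhds |>.and self_mem_nhdsWithin : ∀ᶠ a in nhdsWithin c (Set.Ioi c),
        a * ‖w‖ < 1 ∧ a ∈ Set.Ioi c).exists.imp fun _ h => ⟨h.2, h.1⟩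
  obtain ⟨T, hT⟩ := Filter.eventually_atTop.1 (eventually_log_logisticLoss_add_le hR0 hR hη hηR hz
    hw (hc.trans hcc') hc'w)
  have hbound : ∀ t ≥ T, Real.log (logisticLoss v (z t)) + c' * ‖z t‖ ≤
      Real.log (logisticLoss v (z T)) + c' * ‖z T‖ := fun t ht => by
    induction t, ht using Nat.le_induction with
    | base => rfl
    | succ t ht ih => exact (hT t ht).trans ih
  set D := Real.log (logisticLoss v (z T)) + c' * ‖z T‖
  refine Filter.eventually_all.2 fun k => ?_
  have hlarge := ((tendsto_norm_atTop hG).const_mul_atTop (sub_pos.2 hcc')).eventually_ge_atTop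
    (D + Real.log 2)
  filter_upwards [Filter.eventually_ge_atTop T, hlarge,
    (tendsto_exp_neg_margin_zero hG k).eventually_le_const zero_lt_one] with t ht hl he
  have hs := Real.exp_pos (-⟪z t, v k⟫)
  have hloss : Real.exp (-⟪z t, v k⟫) / 2 ≤ logisticLoss v (z t) := by
    refine le_trans ?_ (Finset.single_le_sum (f := fun k => Real.log (1 + Real.exp (-⟪z t, v k⟫)))
      (fun k _ => Real.log_nonneg (by linarith [Real.exp_pos (-⟪z t, v k⟫)])) (Finset.mem_univ k))
    refine le_trans ?_ (Real.one_sub_inv_le_log_of_pos (by positivity))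
    rw [show 1 - (1 + Real.exp (-⟪z t, v k⟫))⁻¹ =
      Real.exp (-⟪z t, v k⟫) / (1 + Real.exp (-⟪z t, v k⟫)) by field_simp; ring]
    gcongr
    linarith
  have hlog := Real.log_le_log (by positivity) hloss
  rw [Real.log_div hs.ne' two_ne_zero, Real.log_exp] at hlog
  linarith [hbound t ht]

end iterates

/-- Gradient descent on the logistic loss with a small step size converges in direction to the
maximal margin vector. -/
lemma tendsto_direction_gradient_descent_logisticLoss [CompleteSpace E] [Nonempty K] (v : K → E) :
    ∃ η₀ > (0 : ℝ), ∀ η : ℝ, 0 < η → η < η₀ → ∀ z : ℕ → E,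
      (∀ t, z (t + 1) = z t - η • gradient (logisticLoss v) (z t)) →
      ∀ w : E, (∀ k, 1 ≤ ⟪w, v k⟫) → (∀ u, (∀ k, 1 ≤ ⟪u, v k⟫) → ‖w‖ ^ 2 ≤ ‖u‖ ^ 2) →
        Filter.Tendsto (fun t => ‖z t‖⁻¹ • z t) Filter.atTop (nhds (‖w‖⁻¹ • w)) := by
  set R := ∑ k, ‖v k‖
  have hR0 : 0 ≤ R := Finset.sum_nonneg fun k _ => norm_nonneg _
  have hR : ∀ k, ‖v k‖ ≤ R := fun k =>
    Finset.single_le_sum (f := fun k => ‖v k‖) (fun k _ => norm_nonneg _) (Finset.mem_univ k)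
  refine ⟨1 / (2 * (R ^ 2 * Fintype.card K) + 1), by positivity, ?_⟩
  intro η hη hη₀ z hz w hw hmin
  have hηR : η * (R ^ 2 * Fintype.card K) ≤ 1 / 2 := by
    rw [lt_div_iff₀ (by positivity)] at hη₀
    linarith
  have hz' : ∀ t, z (t + 1) = z t + η • logisticStep v (z t) := fun t => by
    rw [hz, (hasGradientAt_logisticLoss v (z t)).gradient, smul_neg, sub_neg_eq_add]
  exact tendsto_direction_of_margin hw hmin
    ((tendsto_norm_atTop (tendsto_logisticWeight_zero hR0 hR hη hηR hz' hw)).eventually_gt_atTop 0)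
    fun c hc hcw => eventually_mul_norm_le_margin hR0 hR hη hηR hz' hw hc hcw

end

/-- **Lemma 1** (adapted from Soudry et al.). Let `x i`, `y j` be linearly separable points
in `ℝ^d`, and let `x̃ i = (x i, 1)`, `ỹ j = (y j, 1)` in `ℝ^{d+1}`. For every sufficiently
small step size, the gradient descent iterates on the cross-entropy loss
`L(z) = ∑ᵢ log(1 + exp(-⟪z, x̃ i⟫)) + ∑ⱼ log(1 + exp(⟪z, ỹ j⟫))`, from any initialization,
converge in direction to `w̄/‖w̄‖`, where `w̄` is the minimum-norm vector satisfying
`⟪z, x̃ i⟫ ≥ 1` and `⟪z, ỹ j⟫ ≤ -1`. -/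
theorem gradient_descent_cross_entropy_converges_to_max_margin
    {d : ℕ} {I J : Type*} [Fintype I] [Fintype J] [Nonempty I] [Nonempty J]
    (x : I → EuclideanSpace ℝ (Fin d)) (y : J → EuclideanSpace ℝ (Fin d))
    (hsep : ∃ (w : EuclideanSpace ℝ (Fin d)) (b : ℝ),
      (∀ i, 0 < ⟪w, x i⟫ + b) ∧ (∀ j, ⟪w, y j⟫ + b < 0))
    (xt : I → EuclideanSpace ℝ (Fin (d + 1)))
    (yt : J → EuclideanSpace ℝ (Fin (d + 1)))
    (hxt : ∀ i, (∀ l : Fin d, xt i l.castSucc = x i l) ∧ xt i (Fin.last d) = 1)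
    (hyt : ∀ j, (∀ l : Fin d, yt j l.castSucc = y j l) ∧ yt j (Fin.last d) = 1)
    (L : EuclideanSpace ℝ (Fin (d + 1)) → ℝ)
    (hL : ∀ z, L z = ∑ i, Real.log (1 + Real.exp (-⟪z, xt i⟫))
      + ∑ j, Real.log (1 + Real.exp (⟪z, yt j⟫))) :
    ∃ η₀ > (0 : ℝ), ∀ η : ℝ, 0 < η → η < η₀ →
      ∀ z : ℕ → EuclideanSpace ℝ (Fin (d + 1)),
        (∀ t, z (t + 1) = z t - η • gradient L (z t)) →
        ∀ wbar : EuclideanSpace ℝ (Fin (d + 1)),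
          (∀ i, 1 ≤ ⟪wbar, xt i⟫) → (∀ j, ⟪wbar, yt j⟫ ≤ -1) →
          (∀ z' : EuclideanSpace ℝ (Fin (d + 1)),
            (∀ i, 1 ≤ ⟪z', xt i⟫) → (∀ j, ⟪z', yt j⟫ ≤ -1) →
            ‖wbar‖ ^ 2 ≤ ‖z'‖ ^ 2) →
          Filter.Tendsto (fun t => ‖z t‖⁻¹ • z t) Filter.atTop
            (nhds (‖wbar‖⁻¹ • wbar)) := by
  have hLv : L = logisticLoss (Sum.elim xt fun j => -yt j) := funext fun z => by
    simp [hL, logisticLoss]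
  obtain ⟨η₀, hη₀, h⟩ :=
    tendsto_direction_gradient_descent_logisticLoss (Sum.elim xt fun j => -yt j)
  rw [← hLv] at h
  refine ⟨η₀, hη₀, fun η hη hlt z hz wbar hx hy hmin => h η hη hlt z hz wbar ?_ ?_⟩
  · rintro (i | j)
    · exact hx i
    · simpa [le_neg] using hy j
  · intro u hu
    exact hmin u (fun i => hu (.inl i)) fun j => by simpa [le_neg] using hu (.inr j)
end

section
/- Let {x_i}_{i∈I} and {y_j}_{j∈J} be finite families of points in ℝ^d that are linearly separable with hard margin γ > 0. Define R_x = max{‖x_i − x_{i'}‖ : i, i' ∈ I} and R_y = max{‖y_j − y_{j'}‖ : j, j' ∈ J}. If 2γ ≥ 5·max(R_x, R_y), then for every i∈I and j∈J, the vector ŵ = x_i − y_j (the direction produced by a single stochastic-gradient step from w = 0 on the pair (i, j)), together with the bias b̂ = −(1/2)·min_{i'∈I} ⟨ŵ, x_{i'}⟩ − (1/2)·max_{j'∈J} ⟨ŵ, y_{j'}⟩, satisfies ⟨ŵ, x_{i'}⟩ + b̂ ≥ 0 for all i'∈I and ⟨ŵ, y_{j'}⟩ + b̂ ≤ 0 for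 all j'∈J. -/
open scoped RealInnerProductSpace

/-- If `v` is at distance at most `‖w‖` from `w`, then `v` has nonnegative inner product
with `w`. -/
theorem inner_nonneg_of_norm_sub_le {E : Type*} [NormedAddCommGroup E] [InnerProductSpace ℝ E]
    {w v : E} (h : ‖w - v‖ ≤ ‖w‖) : 0 ≤ ⟪w, v⟫ := by
  have hsq := norm_sub_sq_real w v
  nlinarith [norm_nonneg (w - v), sq_nonneg ‖v‖]

/-- **Theorem 3.** Let `x i`, `y j` be linearly separable points in `ℝ^d` with hard margin
`γ > 0`, and let `R_x`, `R_y` be the diameters of the two classes. If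
`2γ ≥ 5 max(R_x, R_y)`, then for every `i, j`, the weight `ŵ = x i - y j` produced by a
single stochastic-gradient step from zero, with the bias
`b̂ = -(1/2) minᵢ' ⟪ŵ, x i'⟫ - (1/2) maxⱼ' ⟪ŵ, y j'⟫`, classifies all points correctly:
`⟪ŵ, x i'⟫ + b̂ ≥ 0` for all `i'` and `⟪ŵ, y j'⟫ + b̂ ≤ 0` for all `j'`. -/
theorem single_sgd_step_separates
    {d : ℕ} {I J : Type*} [Fintype I] [Fintype J] [Nonempty I] [Nonempty J]
    (x : I → EuclideanSpace ℝ (Fin d)) (y : J → EuclideanSpace ℝ (Fin d))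
    (hsep : ∃ (w : EuclideanSpace ℝ (Fin d)) (b : ℝ),
      (∀ i, 0 < ⟪w, x i⟫ + b) ∧ (∀ j, ⟪w, y j⟫ + b < 0))
    (γ : ℝ) (hγ : 0 < γ)
    (hmargin : IsGreatest {c : ℝ | ∃ u : EuclideanSpace ℝ (Fin d), ‖u‖ = 1 ∧
      ∀ i j, c ≤ ⟪x i - y j, u⟫} (2 * γ))
    (Rx Ry : ℝ)
    (hRx : IsGreatest {c : ℝ | ∃ i i', c = ‖x i - x i'‖} Rx)
    (hRy : IsGreatest {c : ℝ | ∃ j j', c = ‖y j - y j'‖} Ry)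
    (hsepWell : 5 * max Rx Ry ≤ 2 * γ) :
    ∀ i j, ∀ m M : ℝ,
      IsLeast {c : ℝ | ∃ i', c = ⟪x i - y j, x i'⟫} m →
      IsGreatest {c : ℝ | ∃ j', c = ⟪x i - y j, y j'⟫} M →
      (∀ i', 0 ≤ ⟪x i - y j, x i'⟫ + (-(1 / 2) * m - (1 / 2) * M)) ∧
      (∀ j', ⟪x i - y j, y j'⟫ + (-(1 / 2) * m - (1 / 2) * M) ≤ 0) := by
  obtain ⟨⟨u, hu, hmar⟩, -⟩ := hmargin
  rintro i j m M ⟨⟨a, rfl⟩, hm⟩ ⟨⟨b, rfl⟩, hM⟩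
  have hnorm : 2 * γ ≤ ‖x i - y j‖ := by
    simpa [hu] using (hmar i j).trans (real_inner_le_norm _ _)
  have hx : ‖x a - x i‖ ≤ Rx := hRx.2 ⟨a, i, rfl⟩
  have hy : ‖y j - y b‖ ≤ Ry := hRy.2 ⟨j, b, rfl⟩
  have hdev : ‖(x i - y j) - (x a - y b)‖ ≤ ‖x i - y j‖ := by
    rw [show (x i - y j) - (x a - y b) = -((x a - x i) + (y j - y b)) by abel, norm_neg]
    have := norm_add_le (x a - x i) (y j - y b)
    linarith [le_max_left Rx Ry, le_max_right Rx Ry]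
  have hsep' : 0 ≤ ⟪x i - y j, x a - y b⟫ :=
    inner_nonneg_of_norm_sub_le hdev
  rw [inner_sub_right] at hsep'
  refine ⟨fun i' => ?_, fun j' => ?_⟩
  · linarith [hm ⟨i', rfl⟩]
  · linarith [hM ⟨j', rfl⟩]
end

section
/- Let {x_i}_{i∈I} and {y_j}_{j∈J} be finite families of points in ℝ^d that are linearly separable with hard margin γ > 0. Define R_x = max{‖x_i − x_{i'}‖ : i, i' ∈ I} and R_y = max{‖y_j − y_{j'}‖ : j, j' ∈ J}. If 2γ ≥ 5·max(R_x, R_y), then ⟨x_{i'} − y_{j'}, x_i − y_j⟩ > 0 for all i, i' ∈ I and all j, j' ∈ J. -/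
open scoped RealInnerProductSpace

/-- (Proof of Theorem 3.) Let `x i`, `y j` be linearly separable points in `ℝ^d` with hard
margin `γ > 0`, and let `R_x`, `R_y` be the diameters of the two classes. If
`2γ ≥ 5 max(R_x, R_y)`, then all pairwise differences across the two classes are positively
correlated: `⟪x i' - y j', x i - y j⟫ > 0` for all `i, i', j, j'`. -/
theorem pairwise_differences_positively_correlated
    {d : ℕ} {I J : Type*} [Fintype I] [Fintype J] [Nonempty I] [Nonempty J]
    (x : I → EuclideanSpace ℝ (Fin d)) (y : J → EuclideanSpace ℝ (Fin d))
    (hsep : ∃ (w : EuclideanSpace ℝ (Fin d)) (b : ℝ),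
      (∀ i, 0 < ⟪w, x i⟫ + b) ∧ (∀ j, ⟪w, y j⟫ + b < 0))
    (γ : ℝ) (hγ : 0 < γ)
    (hmargin : IsGreatest {c : ℝ | ∃ u : EuclideanSpace ℝ (Fin d), ‖u‖ = 1 ∧
      ∀ i j, c ≤ ⟪x i - y j, u⟫} (2 * γ))
    (Rx Ry : ℝ)
    (hRx : IsGreatest {c : ℝ | ∃ i i', c = ‖x i - x i'‖} Rx)
    (hRy : IsGreatest {c : ℝ | ∃ j j', c = ‖y j - y j'‖} Ry)
    (hsepWell : 5 * max Rx Ry ≤ 2 * γ) :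
    ∀ (i i' : I) (j j' : J), 0 < ⟪x i' - y j', x i - y j⟫ := by
  intro i i' j j'
  obtain ⟨u, hu, hmin⟩ := hmargin.1
  have norm_ge : ∀ k l, 2 * γ ≤ ‖x k - y l‖ := fun k l => by
    simpa [hu] using (hmin k l).trans (real_inner_le_norm (x k - y l) u)
  have hx : ‖x i' - x i‖ ≤ Rx := hRx.2 ⟨i', i, rfl⟩
  have hy : ‖y j' - y j‖ ≤ Ry := hRy.2 ⟨j', j, rfl⟩
  have hdiff : ‖(x i' - y j') - (x i - y j)‖ ≤ 4 * γ / 5 := by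
    have hsub := norm_sub_le (x i' - x i) (y j' - y j)
    rw [sub_sub_sub_comm]
    linarith [le_max_left Rx Ry, le_max_right Rx Ry]
  have hpolar := norm_sub_sq_real (x i' - y j') (x i - y j)
  have ha := pow_le_pow_left₀ (by positivity) (norm_ge i' j') 2
  have hb := pow_le_pow_left₀ (by positivity) (norm_ge i j) 2
  have hc := pow_le_pow_left₀ (norm_nonneg _) hdiff 2
  nlinarith [pow_pos hγ 2]
end

section
/- Fix a finite family of vectors {h_i}_{i∈I} in ℝ^m. Let W : [0, ∞) → Mat_{n×m}(ℝ) and w : [0, ∞) → ℝⁿ be differentiable curves satisfying the gradient-flow equations of the loss Σ_{i∈I} log(1 + exp(−wᵀ W h_i)), namely W′(t) = w(t) v(t)ᵀ and w′(t) = W(t) v(t), where v(t) = Σ_{i∈I} h_i · exp(−⟨w(t), W(t) h_i⟩) / (1 + exp(−⟨w(t), W(t) h_i⟩)). If W(0) = 0, then for every t ≥ 0 there exist a scalar α(t) ∈ ℝ and a vector c(t) ∈ ℝ^m such that w(t) = α(t) · w(0) and W(t) = w(0) · c(t)ᵀ; in particular, W(t) has rank at most 1 and every feature vector W(t) h_i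 lies in the one-dimensional subspace spanned by w(0), so the family {W(t) h_i}_{i∈I} spans a subspace of dimension at most 1. -/
/-- Solutions of the linear system `a' = ∑ l, v l • b l`, `b l' = v l • a` with bounded coefficients
`v` vanish identically when they vanish at time `0`. -/
theorem eq_zero_of_hasDerivAt_bounded_coupling {E ι : Type*} [NormedAddCommGroup E]
    [NormedSpace ℝ E] [Fintype ι] {a : ℝ → E} {b : ℝ → ι → E} {v : ℝ → ι → ℝ} {C : ℝ}
    (hv : ∀ t, ‖v t‖ ≤ C)
    (ha : ∀ t, 0 ≤ t → HasDerivAt a (∑ l, v t l • b t l) t)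
    (hb : ∀ t, 0 ≤ t → HasDerivAt b (fun l => v t l • a t) t)
    (ha0 : a 0 = 0) (hb0 : b 0 = 0) {t : ℝ} (ht : 0 ≤ t) : a t = 0 ∧ b t = 0 := by
  have hC : 0 ≤ C := (norm_nonneg _).trans (hv 0)
  have hab (s : ℝ) (hs : 0 ≤ s) := (ha s hs).prodMk (hb s hs)
  have hbound (s : ℝ) : ‖(∑ l, v s l • b s l, fun l => v s l • a s)‖ ≤
      ((Fintype.card ι + 1) * C) * ‖(a s, b s)‖ := by
    have ha_le : ‖a s‖ ≤ ‖(a s, b s)‖ := norm_fst_le (a s, b s)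
    have hb_le : ‖b s‖ ≤ ‖(a s, b s)‖ := norm_snd_le (a s, b s)
    have hv_le (l : ι) : ‖v s l‖ ≤ C := (norm_le_pi_norm _ l).trans (hv s)
    have hCn : 0 ≤ C * ‖(a s, b s)‖ := by positivity
    have hcard : (0 : ℝ) ≤ Fintype.card ι := Nat.cast_nonneg _
    refine norm_prod_le_iff.2 ⟨?_, (pi_norm_le_iff_of_nonneg (by positivity)).2 fun l => ?_⟩
    · calc ‖∑ l, v s l • b s l‖ ≤ ∑ _l : ι, C * ‖(a s, b s)‖ := by
            refine norm_sum_le_of_le _ fun l _ => ?_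
            rw [norm_smul]
            gcongr
            · exact hv_le l
            · exact (norm_le_pi_norm _ l).trans hb_le
        _ ≤ _ := by
            rw [Finset.sum_const, Finset.card_univ, nsmul_eq_mul]
            nlinarith
    · calc ‖v s l • a s‖ ≤ C * ‖(a s, b s)‖ := by
            rw [norm_smul]
            gcongr
            exact hv_le l
        _ ≤ _ := by nlinarith [mul_nonneg hcard hCn]
  have h := eq_zero_of_abs_deriv_le_mul_abs_self_of_eq_zero_right
    (f := fun s => (a s, b s)) (a := 0) (b := t)
    (fun s hs => (hab s hs.1).continuousAt.continuousWithinAt)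
    (fun s hs => (hab s hs.1).hasDerivWithinAt) (Prod.ext ha0 hb0)
    (fun s _ => hbound s) t ⟨ht, le_rfl⟩
  exact Prod.mk_eq_zero.1 h

theorem norm_sum_exp_div_one_add_exp_smul_le {E ι : Type*} [SeminormedAddCommGroup E]
    [NormedSpace ℝ E] [Fintype ι] (x : ι → ℝ) (h : ι → E) :
    ‖∑ i, (Real.exp (x i) / (1 + Real.exp (x i))) • h i‖ ≤ ∑ i, ‖h i‖ := by
  refine norm_sum_le_of_le _ fun i _ => ?_
  rw [norm_smul, Real.norm_of_nonneg (by positivity)]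
  refine mul_le_of_le_one_left (norm_nonneg _) ?_
  rw [div_le_one (by positivity)]
  linarith

/-- Along a two-layer linear flow `W' = w vᵀ`, `w' = W v` with bounded `v` and `W 0 = 0`, the vector
`w` and the columns of `W` stay in the span of `w 0`. -/
theorem mem_span_of_hasDerivAt_outer_product {n m : ℕ} {W : ℝ → Fin n → Fin m → ℝ}
    {w : ℝ → Fin n → ℝ} {v : ℝ → Fin m → ℝ} {C : ℝ} (hv : ∀ t, ‖v t‖ ≤ C)
    (hW' : ∀ t, 0 ≤ t → HasDerivAt W (fun k l => w t k * v t l) t)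
    (hw' : ∀ t, 0 ≤ t → HasDerivAt w (fun k => ∑ l, W t k l * v t l) t)
    (hW0 : W 0 = 0) {t : ℝ} (ht : 0 ≤ t) :
    w t ∈ Submodule.span ℝ {w 0} ∧ ∀ l, (fun k => W t k l) ∈ Submodule.span ℝ {w 0} := by
  have key (φ : Module.Dual ℝ (Fin n → ℝ))
      (hφ : φ ∈ (Submodule.span ℝ {w 0}).dualAnnihilator) :
      φ (w t) = 0 ∧ (fun l => φ fun k => W t k l) = 0 := by
    have hφ' (u : ℝ → Fin n → ℝ) (u' : Fin n → ℝ) (s : ℝ) (hu : HasDerivAt u u' s) :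
        HasDerivAt (fun r => φ (u r)) (φ u') s :=
      (LinearMap.toContinuousLinearMap φ).hasFDerivAt.comp_hasDerivAt s hu
    refine eq_zero_of_hasDerivAt_bounded_coupling hv (a := fun s => φ (w s))
      (b := fun s l => φ fun k => W s k l) (fun s hs => ?_) (fun s hs => ?_) ?_ ?_ ht
    · have hsum : (fun k => ∑ l, W s k l * v s l) = ∑ l, v s l • fun k => W s k l := by
        ext k
        simp [mul_comm]
      have hw := hφ' w _ s (hw' s hs)
      rw [hsum, map_sum] at hw
      simpa only [map_smul] using hw
    · refine hasDerivAt_pi.2 fun l => ?_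
      have hcol : HasDerivAt (fun r k => W r k l) (fun k => w s k * v s l) s :=
        hasDerivAt_pi.2 fun k => hasDerivAt_pi.1 (hasDerivAt_pi.1 (hW' s hs) k) l
      have hsmul : (fun k => w s k * v s l) = v s l • w s := by
        ext k
        simp [mul_comm]
      rw [hsmul] at hcol
      simpa only [map_smul] using hφ' _ _ s hcol
    · exact (Submodule.mem_dualAnnihilator φ).1 hφ _ (Submodule.mem_span_singleton_self _)
    · ext l
      rw [hW0]
      exact map_zero φ
  exact ⟨(Subspace.forall_mem_dualAnnihilator_apply_eq_zero_iff _ _).1 fun φ hφ => (key φ hφ).1,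
    fun l => (Subspace.forall_mem_dualAnnihilator_apply_eq_zero_iff _ _).1
      fun φ hφ => congrFun (key φ hφ).2 l⟩

/-- **Proposition 1** (gradient-flow version). Consider the gradient flow of the loss
`∑ᵢ log(1 + exp(-wᵀ W hᵢ))` in the pair `(W, w)`, i.e. `W' = w vᵀ`, `w' = W v` with
`v(t) = ∑ᵢ (exp(-⟪w, W hᵢ⟫)/(1 + exp(-⟪w, W hᵢ⟫))) hᵢ`. If `W(0) = 0`, then for every
`t ≥ 0` we have `w(t) = α(t) w(0)` and `W(t) = w(0) c(t)ᵀ` for some scalar `α(t)` and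
vector `c(t)`; in particular each feature `W(t) hᵢ` lies in `span {w(0)}`, and the family
`{W(t) hᵢ}ᵢ` spans a subspace of dimension at most `1`. -/
theorem gradient_flow_zero_init_rank_one
    {n m : ℕ} {I : Type*} [Fintype I] [Nonempty I]
    (h : I → (Fin m → ℝ))
    (W : ℝ → (Fin n → Fin m → ℝ)) (w : ℝ → (Fin n → ℝ))
    (v : ℝ → (Fin m → ℝ))
    (hv : ∀ t : ℝ, v t = ∑ i,
      (Real.exp (-(∑ k, w t k * ∑ l, W t k l * h i l)) /
        (1 + Real.exp (-(∑ k, w t k * ∑ l, W t k l * h i l)))) • h i)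
    (hW' : ∀ t : ℝ, 0 ≤ t → HasDerivAt W (fun k l => w t k * v t l) t)
    (hw' : ∀ t : ℝ, 0 ≤ t → HasDerivAt w (fun k => ∑ l, W t k l * v t l) t)
    (hW0 : W 0 = 0) :
    ∀ t : ℝ, 0 ≤ t → ∃ (α : ℝ) (c : Fin m → ℝ),
      w t = α • w 0 ∧
      W t = (fun k l => w 0 k * c l) ∧
      (∀ i, (fun k => ∑ l, W t k l * h i l) ∈ Submodule.span ℝ {w 0}) ∧
      Module.finrank ℝ
        ↥(Submodule.span ℝ (Set.range fun i => fun k => ∑ l, W t k l * h i l)) ≤ 1 := by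
  intro t ht
  have hvC (s : ℝ) : ‖v s‖ ≤ ∑ i, ‖h i‖ := by
    rw [hv s]
    exact norm_sum_exp_div_one_add_exp_smul_le _ h
  obtain ⟨hw, hW⟩ := mem_span_of_hasDerivAt_outer_product hvC hW' hw' hW0 ht
  obtain ⟨α, hα⟩ := Submodule.mem_span_singleton.1 hw
  choose c hc using fun l => Submodule.mem_span_singleton.1 (hW l)
  have hfeature (i : I) : (fun k => ∑ l, W t k l * h i l) ∈ Submodule.span ℝ {w 0} := by
    have hsum : (fun k => ∑ l, W t k l * h i l) = ∑ l, h i l • fun k => W t k l := by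
      ext k
      simp [mul_comm]
    rw [hsum]
    exact Submodule.sum_mem _ fun l _ => Submodule.smul_mem _ _ (hW l)
  refine ⟨α, c, hα.symm, ?_, hfeature, ?_⟩
  · ext k l
    rw [← congrFun (hc l) k, Pi.smul_apply, smul_eq_mul, mul_comm]
  · exact (Submodule.finrank_mono (Submodule.span_le.2 (Set.range_subset_iff.2 hfeature))).trans
      ((finrank_span_le_card _).trans (by simp))
end
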